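/- arXiv:2605.21458 — 4 statements merged into one kernel-verified Lean document; each statement's English description precedes it below -/
import Mathlib

section
/- Extended simulation lemma (structural decomposition, Lemma 3.1). Let S be a nonempty finite type, let gamma ∈ [0,1), let R_max ≥ 0, and let r_star, r_bar, r_hat : S → ℝ be reward vectors taking values in [0, R_max]. Let P_star, P_bar, P_hat be row-stochastic S×S real matrices. Suppose there are constants eps_r_h, eps_r_m, eps_p_h, eps_p_m ≥ 0 such that for every s ∈ S: |r_hat s − r_bar s| ≤ eps_r_m and |r_bar s − r_star s| ≤ eps_r_h, and for every s ∈ S: Σ_{s'} |P_hat s s' − P_bar s s'| ≤ eps_p_m and Σ_{s'} |P_bar s s' − P_star s s'| ≤ eps_p_h. Then the value vectors V(r_star, P_star) and V(r_hat, P_hat) satisfy, for every s ∈ S, |V(r_star, P_star) s − V(r_hat, P_hat) s| ≤ (2/(1−gamma))·(eps_r_h + eps_r_m) + (2·gamma·R_max/(1−gamma)^2)·(eps_p_h + eps_p_m). -/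
open Matrix BigOperators

/-- A matrix is row-stochastic if all entries are nonnegative and each row sums to 1. -/
def RowStochastic {S : Type*} [Fintype S] (P : Matrix S S ℝ) : Prop :=
  (∀ s s', 0 ≤ P s s') ∧ ∀ s, ∑ s', P s s' = 1

/-- The discounted value vector `V(r, P) = Σ_t γ^t (P^t *ᵥ r)`, defined pointwise. -/
noncomputable def valueVec {S : Type*} [Fintype S] [DecidableEq S]
    (γ : ℝ) (r : S → ℝ) (P : Matrix S S ℝ) : S → ℝ :=
  fun s => ∑' t : ℕ, γ ^ t * ((P ^ t) *ᵥ r) s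

/-- An entry of `A *ᵥ v` is at most the `ℓ¹`-norm of its row times the sup norm of `v`. -/
theorem abs_mulVec_le_sum_mul {S : Type*} [Fintype S] (A : Matrix S S ℝ) {v : S → ℝ} {B : ℝ}
    (hv : ∀ s, |v s| ≤ B) (s : S) : |(A *ᵥ v) s| ≤ (∑ s', |A s s'|) * B := by
  rw [Matrix.mulVec, dotProduct, Finset.sum_mul]
  refine (Finset.abs_sum_le_sum_abs _ _).trans (Finset.sum_le_sum fun s' _ => ?_)
  rw [abs_mul]
  exact mul_le_mul_of_nonneg_left (hv s') (abs_nonneg _)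

namespace RowStochastic

variable {S : Type*} [Fintype S] {P : Matrix S S ℝ}

theorem abs_mulVec_le (hP : RowStochastic P) {v : S → ℝ} {B : ℝ}
    (hv : ∀ s, |v s| ≤ B) (s : S) : |(P *ᵥ v) s| ≤ B := by
  have h := abs_mulVec_le_sum_mul P hv s
  rwa [Finset.sum_congr rfl fun s' _ => abs_of_nonneg (hP.1 s s'), hP.2 s, one_mul] at h

variable [DecidableEq S]

theorem abs_pow_mulVec_le (hP : RowStochastic P) {r : S → ℝ} {B : ℝ}
    (hr : ∀ s, |r s| ≤ B) (t : ℕ) : ∀ s, |((P ^ t) *ᵥ r) s| ≤ B := by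
  induction t with
  | zero => simpa using hr
  | succ t ih =>
    rw [pow_succ', ← Matrix.mulVec_mulVec]
    exact hP.abs_mulVec_le ih

theorem norm_valueVec_term_le (hP : RowStochastic P) {r : S → ℝ} {B γ : ℝ}
    (hr : ∀ s, |r s| ≤ B) (hγ0 : 0 ≤ γ) (s : S) (t : ℕ) :
    ‖γ ^ t * ((P ^ t) *ᵥ r) s‖ ≤ γ ^ t * B := by
  rw [Real.norm_eq_abs, abs_mul, abs_of_nonneg (pow_nonneg hγ0 t)]
  exact mul_le_mul_of_nonneg_left (hP.abs_pow_mulVec_le hr t s) (pow_nonneg hγ0 t)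

theorem summable_valueVec (hP : RowStochastic P) {r : S → ℝ} {B γ : ℝ}
    (hr : ∀ s, |r s| ≤ B) (hγ0 : 0 ≤ γ) (hγ1 : γ < 1) (s : S) :
    Summable fun t : ℕ => γ ^ t * ((P ^ t) *ᵥ r) s :=
  Summable.of_norm_bounded ((summable_geometric_of_lt_one hγ0 hγ1).mul_right B)
    (hP.norm_valueVec_term_le hr hγ0 s)

theorem abs_valueVec_le (hP : RowStochastic P) {r : S → ℝ} {B γ : ℝ}
    (hr : ∀ s, |r s| ≤ B) (hγ0 : 0 ≤ γ) (hγ1 : γ < 1) (s : S) :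
    |valueVec γ r P s| ≤ B / (1 - γ) := by
  have h := tsum_of_norm_bounded ((hasSum_geometric_of_lt_one hγ0 hγ1).mul_right B)
    (hP.norm_valueVec_term_le hr hγ0 s)
  rwa [Real.norm_eq_abs, inv_mul_eq_div] at h

/-- The Bellman equation `V = r + γ P V`. -/
theorem valueVec_eq (hP : RowStochastic P) {r : S → ℝ} {B γ : ℝ}
    (hr : ∀ s, |r s| ≤ B) (hγ0 : 0 ≤ γ) (hγ1 : γ < 1) (s : S) :
    valueVec γ r P s = r s + γ * (P *ᵥ valueVec γ r P) s := by
  have hsum := hP.summable_valueVec hr hγ0 hγ1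
  have hstep (t : ℕ) : γ ^ (t + 1) * ((P ^ (t + 1)) *ᵥ r) s =
      γ * ∑ s', P s s' * (γ ^ t * ((P ^ t) *ᵥ r) s') := by
    rw [pow_succ' P, ← Matrix.mulVec_mulVec, Matrix.mulVec, dotProduct, Finset.mul_sum,
      Finset.mul_sum]
    exact Finset.sum_congr rfl fun s' _ => by ring
  rw [valueVec, (hsum s).tsum_eq_zero_add, tsum_congr hstep, tsum_mul_left,
    Summable.tsum_finsetSum fun s' _ => (hsum s').mul_left (P s s')]
  simp only [tsum_mul_left, pow_zero, Matrix.one_mulVec, one_mul]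
  rfl

end RowStochastic

/-- The simulation lemma for two discounted Markov reward processes. -/
theorem abs_valueVec_sub_le {S : Type*} [Fintype S] [DecidableEq S]
    {γ B εr εp : ℝ} (hγ0 : 0 ≤ γ) (hγ1 : γ < 1) (hB : 0 ≤ B) {r₁ r₂ : S → ℝ}
    (hr₁ : ∀ s, |r₁ s| ≤ B) (hr₂ : ∀ s, |r₂ s| ≤ B) {P₁ P₂ : Matrix S S ℝ}
    (hP₁ : RowStochastic P₁) (hP₂ : RowStochastic P₂)
    (hr : ∀ s, |r₁ s - r₂ s| ≤ εr) (hP : ∀ s, ∑ s', |P₁ s s' - P₂ s s'| ≤ εp) (s : S) :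
    |valueVec γ r₁ P₁ s - valueVec γ r₂ P₂ s| ≤
      εr / (1 - γ) + γ * B / (1 - γ) ^ 2 * εp := by
  have hγ : 0 < 1 - γ := sub_pos.2 hγ1
  set V₁ := valueVec γ r₁ P₁
  set V₂ := valueVec γ r₂ P₂
  have : Nonempty S := ⟨s⟩
  obtain ⟨m, hm⟩ := Finite.exists_max fun s => |V₁ s - V₂ s|
  refine (hm s).trans ?_
  have hdecomp : V₁ m - V₂ m =
      (r₁ m - r₂ m) + γ * ((P₁ *ᵥ (V₁ - V₂)) m + ((P₁ - P₂) *ᵥ V₂) m) := by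
    rw [Matrix.mulVec_sub, Matrix.sub_mulVec, Pi.sub_apply, Pi.sub_apply,
      show V₁ m = _ from hP₁.valueVec_eq hr₁ hγ0 hγ1 m,
      show V₂ m = _ from hP₂.valueVec_eq hr₂ hγ0 hγ1 m]
    ring
  have hfst : |(P₁ *ᵥ (V₁ - V₂)) m| ≤ |V₁ m - V₂ m| := hP₁.abs_mulVec_le hm m
  have hsnd : |((P₁ - P₂) *ᵥ V₂) m| ≤ εp * (B / (1 - γ)) :=
    (abs_mulVec_le_sum_mul _ (hP₂.abs_valueVec_le hr₂ hγ0 hγ1) m).trans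
      (mul_le_mul_of_nonneg_right (hP m) (div_nonneg hB hγ.le))
  have hmain : |V₁ m - V₂ m| ≤ εr + γ * (|V₁ m - V₂ m| + εp * (B / (1 - γ))) := by
    conv_lhs => rw [hdecomp]
    refine (abs_add_le _ _).trans (add_le_add (hr m) ?_)
    rw [abs_mul, abs_of_nonneg hγ0]
    exact mul_le_mul_of_nonneg_left ((abs_add_le _ _).trans (add_le_add hfst hsnd)) hγ0
  have hrhs : εr / (1 - γ) + γ * B / (1 - γ) ^ 2 * εp =
      (εr + γ * (εp * (B / (1 - γ)))) / (1 - γ) := by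
    field_simp
  rw [hrhs, le_div_iff₀ hγ]
  linarith

theorem extended_simulation_lemma
    {S : Type*} [Fintype S] [DecidableEq S] [Nonempty S]
    (γ R_max : ℝ) (hγ0 : 0 ≤ γ) (hγ1 : γ < 1) (hR : 0 ≤ R_max)
    (r_star r_bar r_hat : S → ℝ)
    (hstar : ∀ s, r_star s ∈ Set.Icc 0 R_max)
    (hbar : ∀ s, r_bar s ∈ Set.Icc 0 R_max)
    (hhat : ∀ s, r_hat s ∈ Set.Icc 0 R_max)
    (P_star P_bar P_hat : Matrix S S ℝ)
    (hPstar : RowStochastic P_star) (hPbar : RowStochastic P_bar)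
    (hPhat : RowStochastic P_hat)
    (eps_r_h eps_r_m eps_p_h eps_p_m : ℝ)
    (h1 : 0 ≤ eps_r_h) (h2 : 0 ≤ eps_r_m) (h3 : 0 ≤ eps_p_h) (h4 : 0 ≤ eps_p_m)
    (hrm : ∀ s, |r_hat s - r_bar s| ≤ eps_r_m)
    (hrh : ∀ s, |r_bar s - r_star s| ≤ eps_r_h)
    (hpm : ∀ s, ∑ s', |P_hat s s' - P_bar s s'| ≤ eps_p_m)
    (hph : ∀ s, ∑ s', |P_bar s s' - P_star s s'| ≤ eps_p_h) :
    ∀ s, |valueVec γ r_star P_star s - valueVec γ r_hat P_hat s| ≤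
      (2 / (1 - γ)) * (eps_r_h + eps_r_m) +
      (2 * γ * R_max / (1 - γ) ^ 2) * (eps_p_h + eps_p_m) := by
  intro s
  have hγ : 0 < 1 - γ := sub_pos.2 hγ1
  have habs {r : S → ℝ} (h : ∀ s, r s ∈ Set.Icc 0 R_max) (s : S) : |r s| ≤ R_max :=
    (abs_of_nonneg (h s).1).trans_le (h s).2
  have hr (s : S) : |r_star s - r_hat s| ≤ eps_r_h + eps_r_m := by
    refine (abs_sub_le _ (r_bar s) _).trans (add_le_add ?_ ?_)
    · rw [abs_sub_comm]; exact hrh s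
    · rw [abs_sub_comm]; exact hrm s
  have hP (s : S) : ∑ s', |P_star s s' - P_hat s s'| ≤ eps_p_h + eps_p_m := by
    refine le_trans ?_ (add_le_add (hph s) (hpm s))
    rw [← Finset.sum_add_distrib]
    refine Finset.sum_le_sum fun s' _ => (abs_sub_le _ (P_bar s s') _).trans_eq ?_
    rw [abs_sub_comm (P_star s s'), abs_sub_comm (P_bar s s') (P_hat s s')]
  refine (abs_valueVec_sub_le hγ0 hγ1 hR (habs hstar) (habs hhat) hPstar hPhat hr hP s).trans ?_
  have hre : 0 ≤ (eps_r_h + eps_r_m) / (1 - γ) := by positivity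
  have hpe : 0 ≤ γ * R_max / (1 - γ) ^ 2 * (eps_p_h + eps_p_m) := by positivity
  calc _ ≤ 2 * ((eps_r_h + eps_r_m) / (1 - γ)) +
        2 * (γ * R_max / (1 - γ) ^ 2 * (eps_p_h + eps_p_m)) := by linarith
    _ = _ := by ring
end

section
/- Transition-only perturbation bound (the Δ_p bound of the value-decomposition theorem). Let S be a nonempty finite type, gamma ∈ [0,1), R_max ≥ 0, and let r : S → ℝ be a reward vector taking values in [0, R_max]. Let P, P_hat be row-stochastic S×S real matrices such that for every s ∈ S, Σ_{s'} |P s s' − P_hat s s'| ≤ eps_p, for some eps_p ≥ 0. Then for every s ∈ S, |V(r, P) s − V(r, P_hat) s| ≤ 2·gamma·R_max·eps_p/(1−gamma)^2. -/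
open Matrix BigOperators

theorem abs_mulVec_apply_le {S : Type*} [Fintype S] {M : Matrix S S ℝ} {v : S → ℝ} {a C : ℝ}
    (hC : 0 ≤ C) (hv : ∀ s, |v s| ≤ C) {s : S} (hM : ∑ s', |M s s'| ≤ a) :
    |(M *ᵥ v) s| ≤ a * C := by
  calc |∑ s', M s s' * v s'| ≤ ∑ s', |M s s' * v s'| := Finset.abs_sum_le_sum_abs _ _
    _ ≤ ∑ s', |M s s'| * C := Finset.sum_le_sum fun s' _ => by
        rw [abs_mul]
        exact mul_le_mul_of_nonneg_left (hv s') (abs_nonneg _)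
    _ = (∑ s', |M s s'|) * C := (Finset.sum_mul _ _ _).symm
    _ ≤ a * C := mul_le_mul_of_nonneg_right hM hC

theorem RowStochastic.sum_abs_eq_one {S : Type*} [Fintype S] {P : Matrix S S ℝ}
    (hP : RowStochastic P) (s : S) : ∑ s', |P s s'| = 1 := by
  simp only [abs_of_nonneg (hP.1 s _), hP.2 s]

theorem RowStochastic.abs_pow_mulVec_le_s2 {S : Type*} [Fintype S] [DecidableEq S]
    {P : Matrix S S ℝ} (hP : RowStochastic P) {r : S → ℝ} {C : ℝ} (hC : 0 ≤ C)
    (hr : ∀ s, |r s| ≤ C) (t : ℕ) (s : S) : |((P ^ t) *ᵥ r) s| ≤ C := by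
  induction t generalizing s with
  | zero => simpa using hr s
  | succ t ih =>
    rw [pow_succ', ← Matrix.mulVec_mulVec]
    simpa using abs_mulVec_apply_le hC ih (hP.sum_abs_eq_one s).le

theorem RowStochastic.abs_pow_mulVec_sub_le {S : Type*} [Fintype S] [DecidableEq S]
    {P Q : Matrix S S ℝ} (hP : RowStochastic P) (hQ : RowStochastic Q) {r : S → ℝ} {C ε : ℝ}
    (hC : 0 ≤ C) (hε : 0 ≤ ε) (hr : ∀ s, |r s| ≤ C)
    (hPQ : ∀ s, ∑ s', |P s s' - Q s s'| ≤ ε) (t : ℕ) (s : S) :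
    |((P ^ t) *ᵥ r) s - ((Q ^ t) *ᵥ r) s| ≤ t * (ε * C) := by
  induction t generalizing s with
  | zero => simp
  | succ t ih =>
    have key : ((P ^ (t + 1)) *ᵥ r) s - ((Q ^ (t + 1)) *ᵥ r) s =
        (P *ᵥ ((P ^ t) *ᵥ r - (Q ^ t) *ᵥ r)) s + ((P - Q) *ᵥ ((Q ^ t) *ᵥ r)) s := by
      simp only [pow_succ', ← Matrix.mulVec_mulVec, Matrix.mulVec_sub, Matrix.sub_mulVec,
        Pi.sub_apply]
      ring
    have h₁ : |(P *ᵥ ((P ^ t) *ᵥ r - (Q ^ t) *ᵥ r)) s| ≤ 1 * (t * (ε * C)) :=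
      abs_mulVec_apply_le (by positivity) ih (hP.sum_abs_eq_one s).le
    have h₂ : |((P - Q) *ᵥ ((Q ^ t) *ᵥ r)) s| ≤ ε * C :=
      abs_mulVec_apply_le hC (hQ.abs_pow_mulVec_le_s2 hC hr t) (hPQ s)
    rw [key]
    push_cast
    linarith [abs_add_le ((P *ᵥ ((P ^ t) *ᵥ r - (Q ^ t) *ᵥ r)) s)
      (((P - Q) *ᵥ ((Q ^ t) *ᵥ r)) s)]

theorem RowStochastic.summable_discounted {S : Type*} [Fintype S] [DecidableEq S]
    {P : Matrix S S ℝ} (hP : RowStochastic P) {r : S → ℝ} {C γ : ℝ} (hγ0 : 0 ≤ γ) (hγ1 : γ < 1)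
    (hC : 0 ≤ C) (hr : ∀ s, |r s| ≤ C) (s : S) :
    Summable fun t : ℕ => γ ^ t * ((P ^ t) *ᵥ r) s := by
  refine Summable.of_norm_bounded ((summable_geometric_of_lt_one hγ0 hγ1).mul_right C) fun t => ?_
  rw [Real.norm_eq_abs, abs_mul, abs_of_nonneg (pow_nonneg hγ0 t)]
  exact mul_le_mul_of_nonneg_left (hP.abs_pow_mulVec_le_s2 hC hr t s) (pow_nonneg hγ0 t)

theorem hasSum_nat_mul_geometric_mul {γ : ℝ} (hγ0 : 0 ≤ γ) (hγ1 : γ < 1) (c : ℝ) :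
    HasSum (fun t : ℕ => (t * γ ^ t : ℝ) * c) (γ / (1 - γ) ^ 2 * c) := by
  have hγ : ‖γ‖ < 1 := by rwa [Real.norm_eq_abs, abs_of_nonneg hγ0]
  exact (hasSum_coe_mul_geometric_of_norm_lt_one hγ).mul_right c

theorem transition_only_perturbation_bound
    {S : Type*} [Fintype S] [DecidableEq S] [Nonempty S]
    (γ R_max : ℝ) (hγ0 : 0 ≤ γ) (hγ1 : γ < 1) (hR : 0 ≤ R_max)
    (r : S → ℝ) (hr : ∀ s, r s ∈ Set.Icc 0 R_max)
    (eps_p : ℝ) (heps : 0 ≤ eps_p)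
    (P P_hat : Matrix S S ℝ) (hP : RowStochastic P) (hPhat : RowStochastic P_hat)
    (hclose : ∀ s, ∑ s', |P s s' - P_hat s s'| ≤ eps_p) :
    ∀ s, |valueVec γ r P s - valueVec γ r P_hat s| ≤
      2 * γ * R_max * eps_p / (1 - γ) ^ 2 := by
  intro s
  have hr' : ∀ s, |r s| ≤ R_max := fun s => by
    rw [abs_of_nonneg (hr s).1]
    exact (hr s).2
  have hbound : |valueVec γ r P s - valueVec γ r P_hat s| ≤
      γ / (1 - γ) ^ 2 * (eps_p * R_max) := by
    unfold valueVec
    rw [← (hP.summable_discounted hγ0 hγ1 hR hr' s).tsum_sub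
      (hPhat.summable_discounted hγ0 hγ1 hR hr' s), ← Real.norm_eq_abs]
    refine tsum_of_norm_bounded (hasSum_nat_mul_geometric_mul hγ0 hγ1 (eps_p * R_max)) fun t => ?_
    rw [← mul_sub, Real.norm_eq_abs, abs_mul, abs_of_nonneg (pow_nonneg hγ0 t)]
    have hdiff := mul_le_mul_of_nonneg_left
      (hP.abs_pow_mulVec_sub_le hPhat hR heps hr' hclose t s) (pow_nonneg hγ0 t)
    linarith
  have hnonneg : 0 ≤ γ / (1 - γ) ^ 2 * (eps_p * R_max) := by positivity
  have hdouble : 2 * γ * R_max * eps_p / (1 - γ) ^ 2 =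
      2 * (γ / (1 - γ) ^ 2 * (eps_p * R_max)) := by ring
  rw [hdouble]
  linarith
end

section
/- Existence and uniqueness of the experimentation threshold. For every gamma ∈ (0, 1], there exists a unique kappa > 0 satisfying 2·gamma·psi(kappa) = kappa, where psi(r) = φ(r) − r·Φ(−r), φ(x) = (2π)^{-1/2}·exp(−x²/2) is the standard normal density, and Φ(x) is the N(0,1)-measure of the interval (−∞, x]. -/
open MeasureTheory ProbabilityTheory

/-- The standard normal density `φ(x) = (2π)^{-1/2} exp(-x²/2)`. -/
noncomputable def stdGaussPdf (x : ℝ) : ℝ :=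
  (Real.sqrt (2 * Real.pi))⁻¹ * Real.exp (-x ^ 2 / 2)

/-- The standard normal CDF `Φ(x)`: the `N(0,1)`-measure of `{z : z ≤ x}`. -/
noncomputable def stdGaussCdf (x : ℝ) : ℝ :=
  ((gaussianReal 0 1) {z : ℝ | z ≤ x}).toReal

/-- `ψ(r) = φ(r) − r·Φ(−r)`. -/
noncomputable def psiFn (r : ℝ) : ℝ := stdGaussPdf r - r * stdGaussCdf (-r)

theorem stdGaussPdf_eq_gaussianPDFReal : stdGaussPdf = gaussianPDFReal 0 1 := by
  funext x
  simp [stdGaussPdf, gaussianPDFReal]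

theorem continuous_stdGaussPdf : Continuous stdGaussPdf := by
  unfold stdGaussPdf
  fun_prop

theorem integrable_stdGaussPdf : Integrable stdGaussPdf := by
  rw [stdGaussPdf_eq_gaussianPDFReal]
  exact integrable_gaussianPDFReal 0 1

theorem stdGaussPdf_neg (x : ℝ) : stdGaussPdf (-x) = stdGaussPdf x := by
  simp [stdGaussPdf]

theorem stdGaussCdf_nonneg (x : ℝ) : 0 ≤ stdGaussCdf x := ENNReal.toReal_nonneg

theorem stdGaussCdf_eq_integral (x : ℝ) :
    stdGaussCdf x = ∫ t in Set.Iic x, stdGaussPdf t := by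
  rw [stdGaussCdf, gaussianReal_apply_eq_integral 0 one_ne_zero,
    stdGaussPdf_eq_gaussianPDFReal, ENNReal.toReal_ofReal]
  · rfl
  · exact integral_nonneg fun t => gaussianPDFReal_nonneg 0 1 t

theorem hasDerivAt_stdGaussCdf (x : ℝ) : HasDerivAt stdGaussCdf (stdGaussPdf x) x := by
  have h : stdGaussCdf = fun y => stdGaussCdf 0 + ∫ t in (0 : ℝ)..y, stdGaussPdf t := by
    funext y
    rw [stdGaussCdf_eq_integral, stdGaussCdf_eq_integral,
      ← intervalIntegral.integral_Iic_sub_Iic integrable_stdGaussPdf.integrableOn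
        integrable_stdGaussPdf.integrableOn]
    ring
  rw [h]
  exact (continuous_stdGaussPdf.integral_hasStrictDerivAt 0 x).hasDerivAt.const_add _

theorem hasDerivAt_stdGaussPdf (x : ℝ) : HasDerivAt stdGaussPdf (-x * stdGaussPdf x) x := by
  have h : HasDerivAt (fun y : ℝ => -y ^ 2 / 2) (-x) x := by
    refine ((hasDerivAt_pow 2 x).neg.div_const 2).congr_deriv ?_
    norm_num
    ring
  refine (h.exp.const_mul (Real.sqrt (2 * Real.pi))⁻¹).congr_deriv ?_
  rw [stdGaussPdf]
  ring

theorem hasDerivAt_psiFn (r : ℝ) : HasDerivAt psiFn (-stdGaussCdf (-r)) r := by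
  have h : HasDerivAt (fun y => stdGaussCdf (-y)) (-stdGaussPdf r) r := by
    refine ((hasDerivAt_stdGaussCdf (-r)).comp r (hasDerivAt_neg r)).congr_deriv ?_
    rw [stdGaussPdf_neg]
    ring
  refine ((hasDerivAt_stdGaussPdf r).sub ((hasDerivAt_id r).mul h)).congr_deriv ?_
  simp only [id]
  ring

theorem continuous_psiFn : Continuous psiFn :=
  continuous_iff_continuousAt.2 fun r => (hasDerivAt_psiFn r).continuousAt

theorem antitone_psiFn : Antitone psiFn :=
  antitone_of_hasDerivAt_nonpos hasDerivAt_psiFn fun r =>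
    neg_nonpos.2 (stdGaussCdf_nonneg (-r))

theorem psiFn_zero_pos : 0 < psiFn 0 := by
  simp only [psiFn, stdGaussPdf, zero_mul, sub_zero]
  positivity

theorem threshold_exists_unique (γ : ℝ) (hγ : γ ∈ Set.Ioc (0 : ℝ) 1) :
    ∃! κ : ℝ, 0 < κ ∧ 2 * γ * psiFn κ = κ := by
  have hγ' : 0 < 2 * γ := mul_pos two_pos hγ.1
  have hmono : StrictMono fun κ => κ - 2 * γ * psiFn κ := fun a b hab => by
    have := mul_le_mul_of_nonneg_left (antitone_psiFn hab.le) hγ'.le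
    dsimp only
    linarith
  have hcont : Continuous fun κ => κ - 2 * γ * psiFn κ :=
    continuous_id.sub (continuous_const.mul continuous_psiFn)
  have hK : 0 < 2 * γ * psiFn 0 := mul_pos hγ' psiFn_zero_pos
  have hle : 2 * γ * psiFn (2 * γ * psiFn 0) ≤ 2 * γ * psiFn 0 :=
    mul_le_mul_of_nonneg_left (antitone_psiFn hK.le) hγ'.le
  obtain ⟨κ, hκ, hroot⟩ := intermediate_value_Icc hK.le hcont.continuousOn
    (show (0 : ℝ) ∈ Set.Icc _ _ from ⟨by simpa using hK.le, by simpa using hle⟩)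
  have hroot' : κ - 2 * γ * psiFn κ = 0 := hroot
  refine ⟨κ, ⟨hκ.1.lt_of_ne ?_, by linarith⟩, fun y hy => hmono.injective ?_⟩
  · rintro rfl
    linarith
  · linarith [hy.2]
end

section
/- Bounded propensity-odds two-sided variance bound (Propositions obs-gap(b) and bpo-sensitivity). Let ι be a nonempty finite type and M ≥ 1. Let p : ι → ℝ be nonnegative with Σ_i p i = 1, and let w : ι → ℝ satisfy 1/M ≤ w i ≤ M for all i and Σ_i p i · w i = 1; define the reweighted distribution q i = p i · w i. Let v : ι → ℝ be nonnegative (per-component conditional variances) and m : ι → ℝ (per-component conditional means), and for a distribution d : ι → ℝ define TotVar(d) = Σ_i d i · v i + Σ_i d i · (m i)^2 − (Σ_i d i · m i)^2. Then (1/M^2) · TotVar(p) ≤ TotVar(q) ≤ M^2 · TotVar(p). -/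
open BigOperators

/-- The total variance of the mixture `d` with component variances `v` and means `m`. -/
noncomputable def totalVariance {ι : Type*} [Fintype ι] (v m d : ι → ℝ) : ℝ :=
  ∑ i, d i * v i + ∑ i, d i * (m i) ^ 2 - (∑ i, d i * m i) ^ 2

/-- Second moment about `c` as total variance plus squared bias. -/
lemma sum_mul_add_sub_sq_eq {ι : Type*} [Fintype ι] (v m d : ι → ℝ)
    (hd : ∑ i, d i = 1) (c : ℝ) :
    ∑ i, d i * (v i + (m i - c) ^ 2) = totalVariance v m d + (∑ i, d i * m i - c) ^ 2 := by
  have h : ∑ i, d i * (v i + (m i - c) ^ 2) = ∑ i, d i * v i + ∑ i, d i * (m i) ^ 2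
      - 2 * c * ∑ i, d i * m i + c ^ 2 * ∑ i, d i := by
    simp only [Finset.mul_sum, ← Finset.sum_add_distrib, ← Finset.sum_sub_distrib]
    exact Finset.sum_congr rfl fun i _ => by ring
  rw [h, hd, totalVariance]
  ring

lemma totalVariance_nonneg {ι : Type*} [Fintype ι] (v m d : ι → ℝ) (hv : ∀ i, 0 ≤ v i)
    (hd0 : ∀ i, 0 ≤ d i) (hd : ∑ i, d i = 1) : 0 ≤ totalVariance v m d := by
  have h := sum_mul_add_sub_sq_eq v m d hd (∑ i, d i * m i)
  rw [sub_self, zero_pow two_ne_zero, add_zero] at h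
  rw [← h]
  exact Finset.sum_nonneg fun i _ => mul_nonneg (hd0 i) (add_nonneg (hv i) (sq_nonneg _))

/-- If `a` is dominated by `C • b`, its total variance is at most `C` times that of `b`. -/
lemma totalVariance_le_mul {ι : Type*} [Fintype ι] (v m a b : ι → ℝ) (C : ℝ)
    (hv : ∀ i, 0 ≤ v i) (ha : ∑ i, a i = 1) (hb : ∑ i, b i = 1)
    (hab : ∀ i, a i ≤ C * b i) : totalVariance v m a ≤ C * totalVariance v m b := by
  set c := ∑ i, b i * m i with hc
  have h₁ := sum_mul_add_sub_sq_eq v m a ha c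
  have h₂ := sum_mul_add_sub_sq_eq v m b hb c
  rw [← hc, sub_self, zero_pow two_ne_zero, add_zero] at h₂
  have h : ∑ i, a i * (v i + (m i - c) ^ 2) ≤ C * ∑ i, b i * (v i + (m i - c) ^ 2) := by
    rw [Finset.mul_sum]
    refine Finset.sum_le_sum fun i _ => ?_
    rw [← mul_assoc]
    exact mul_le_mul_of_nonneg_right (hab i) (add_nonneg (hv i) (sq_nonneg _))
  rw [h₁, h₂] at h
  linarith [sq_nonneg (∑ i, a i * m i - c)]

theorem bounded_propensity_variance_bound {ι : Type*} [Fintype ι] [Nonempty ι]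
    (M : ℝ) (hM : 1 ≤ M)
    (p w : ι → ℝ) (hp0 : ∀ i, 0 ≤ p i) (hp1 : ∑ i, p i = 1)
    (hwlo : ∀ i, 1 / M ≤ w i) (hwhi : ∀ i, w i ≤ M)
    (hq1 : ∑ i, p i * w i = 1)
    (v m : ι → ℝ) (hv : ∀ i, 0 ≤ v i) :
    let TotVar : (ι → ℝ) → ℝ := fun d =>
      ∑ i, d i * v i + ∑ i, d i * (m i) ^ 2 - (∑ i, d i * m i) ^ 2
    let q : ι → ℝ := fun i => p i * w i
    (1 / M ^ 2) * TotVar p ≤ TotVar q ∧ TotVar q ≤ M ^ 2 * TotVar p := by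
  intro TotVar q
  change (1 / M ^ 2) * totalVariance v m p ≤ totalVariance v m q ∧
    totalVariance v m q ≤ M ^ 2 * totalVariance v m p
  have hM0 : 0 < M := by linarith
  have hMsq : M ≤ M ^ 2 := by nlinarith
  have hq0 : ∀ i, 0 ≤ q i := fun i =>
    mul_nonneg (hp0 i) ((one_div_pos.mpr hM0).le.trans (hwlo i))
  have hqp : ∀ i, q i ≤ M * p i := fun i => by
    rw [mul_comm]
    exact mul_le_mul_of_nonneg_left (hwhi i) (hp0 i)
  have hpq : ∀ i, p i ≤ M * q i := fun i => by
    have h : 1 ≤ w i * M := (div_le_iff₀ hM0).mp (hwlo i)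
    change p i ≤ M * (p i * w i)
    nlinarith [mul_le_mul_of_nonneg_left h (hp0 i)]
  constructor
  · rw [one_div_mul_eq_div, div_le_iff₀ (pow_pos hM0 2), mul_comm]
    exact (totalVariance_le_mul v m p q M hv hp1 hq1 hpq).trans
      (mul_le_mul_of_nonneg_right hMsq (totalVariance_nonneg v m q hv hq0 hq1))
  · exact (totalVariance_le_mul v m q p M hv hq1 hp1 hqp).trans
      (mul_le_mul_of_nonneg_right hMsq (totalVariance_nonneg v m p hv hp0 hp1))
end
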